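/- For every positive integer k there exists a tournament G with bimimw(G) ≥ k. -/

import Mathlib

open scoped Classical

/-- An induced matching in a digraph with edge relation `D`: a finite set of edges of `D`,
no two of which share an endpoint, such that no edge of `D` joins an endpoint of one
matching edge to an endpoint of a different matching edge. -/
def IsIndMatching {V : Type} (D : V → V → Prop) (M : Finset (V × V)) : Prop :=
  (∀ e ∈ M, D e.1 e.2) ∧
    ∀ e ∈ M, ∀ f ∈ M, e ≠ f →
      ∀ x, (x = e.1 ∨ x = e.2) → ∀ y, (y = f.1 ∨ y = f.2) → x ≠ y ∧ ¬D x y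

/-- `ν(D)`: the maximum size of an induced matching in the digraph `D`. -/
noncomputable def nu {V : Type} (D : V → V → Prop) : ℕ :=
  sSup {n | ∃ M : Finset (V × V), IsIndMatching D M ∧ M.card = n}

/-- The bipartite digraph `G[A→B]`, whose edges are the edges of `E` from `A` to `B`. -/
def cutRel {V : Type} (E : V → V → Prop) (A B : Set V) : V → V → Prop :=
  fun x y => x ∈ A ∧ y ∈ B ∧ E x y

/-- `bimim_G(A) = ν(G[A→Ā]) + ν(G[Ā→A])`. -/
noncomputable def bimimCut {V : Type} (E : V → V → Prop) (A : Set V) : ℕ :=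
  nu (cutRel E A Aᶜ) + nu (cutRel E Aᶜ A)

/-- For an undirected graph `G`, `mim_G(A) = ν(G[A, Ā])`. -/
noncomputable def mimCut {V : Type} (G : SimpleGraph V) (A : Set V) : ℕ :=
  nu (cutRel G.Adj A Aᶜ)
/-- A caterpillar: a tree containing a path such that every vertex outside the path
has a neighbor on the path. -/
def IsCaterpillar {L : Type} (T : SimpleGraph L) : Prop :=
  ∃ (u v : L) (p : T.Walk u v), p.IsPath ∧
    ∀ w : L, w ∉ p.support → ∃ x ∈ p.support, T.Adj w x

/-- A branch decomposition of a (di)graph on vertex set `V`: a subcubic tree (at least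
two vertices, every internal vertex of degree 3) together with a bijection from `V`
to the set of leaves of the tree. -/
structure BranchDecomp (V : Type) where
  L : Type
  finL : Finite L
  T : SimpleGraph L
  isTree : T.IsTree
  two_le : 2 ≤ Nat.card L
  subcubic : ∀ t : L, (T.neighborSet t).ncard = 1 ∨ (T.neighborSet t).ncard = 3
  toLeaf : V → L
  inj : Function.Injective toLeaf
  mem_leaf : ∀ v : V, (T.neighborSet (toLeaf v)).ncard = 1
  surj : ∀ t : L, (T.neighborSet t).ncard = 1 → ∃ v, toLeaf v = t

/-- The side `A_e` of the cut induced by the tree edge `{t₁, t₂}`: the set of vertices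
mapped to leaves in the component of `T - e` containing `t₁`. -/
def BranchDecomp.side {V : Type} (bd : BranchDecomp V) (t₁ t₂ : bd.L) : Set V :=
  {v | (bd.T.deleteEdges {s(t₁, t₂)}).Reachable t₁ (bd.toLeaf v)}

/-- The bi-mim-width of a branch decomposition with respect to a digraph. -/
noncomputable def BranchDecomp.width {V : Type} (bd : BranchDecomp V)
    (E : V → V → Prop) : ℕ :=
  sSup {n | ∃ t₁ t₂, bd.T.Adj t₁ t₂ ∧ n = bimimCut E (bd.side t₁ t₂)}

/-- The mim-width of a branch decomposition with respect to an undirected graph. -/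
noncomputable def BranchDecomp.uwidth {V : Type} (bd : BranchDecomp V)
    (G : SimpleGraph V) : ℕ :=
  sSup {n | ∃ t₁ t₂, bd.T.Adj t₁ t₂ ∧ n = mimCut G (bd.side t₁ t₂)}

/-- The bi-mim-width of a digraph. -/
noncomputable def bimimw {V : Type} (E : V → V → Prop) : ℕ :=
  sInf {n | ∃ bd : BranchDecomp V, bd.width E = n}

/-- The linear bi-mim-width of a digraph. -/
noncomputable def lbimimw {V : Type} (E : V → V → Prop) : ℕ :=
  sInf {n | ∃ bd : BranchDecomp V, IsCaterpillar bd.T ∧ bd.width E = n}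

/-- The mim-width of an undirected graph. -/
noncomputable def mimw {V : Type} (G : SimpleGraph V) : ℕ :=
  sInf {n | ∃ bd : BranchDecomp V, bd.uwidth G = n}

/-- The linear mim-width of an undirected graph. -/
noncomputable def lmimw {V : Type} (G : SimpleGraph V) : ℕ :=
  sInf {n | ∃ bd : BranchDecomp V, IsCaterpillar bd.T ∧ bd.uwidth G = n}

/-! ### Existence of branch decompositions (a heap-shaped tree) -/

def heapG (N : ℕ) : SimpleGraph (Fin (2 * N + 4)) where
  Adj i j := (i.1 < j.1 ∧ i.1 = (j.1 - 2) / 2) ∨ (j.1 < i.1 ∧ j.1 = (i.1 - 2) / 2)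
  symm := ⟨fun i j h => by omega⟩
  loopless := ⟨fun i h => by omega⟩

lemma heap_reach (N : ℕ) : ∀ (n : ℕ) (h : n < 2 * N + 4),
    (heapG N).Reachable ⟨n, h⟩ ⟨0, by omega⟩ := by
  intro n
  induction n using Nat.strong_induction_on with
  | _ n ih =>
    intro h
    by_cases h0 : n = 0
    · subst h0; exact SimpleGraph.Reachable.refl _
    · have h1 := ih ((n - 2) / 2) (by omega) (by omega)
      refine SimpleGraph.Reachable.trans (SimpleGraph.Adj.reachable ?_) h1
      exact Or.inr ⟨show (n - 2) / 2 < n by omega, rfl⟩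

lemma heap_tree (N : ℕ) : (heapG N).IsTree := by
  rw [SimpleGraph.isTree_iff_connected_and_card]
  have hc : (heapG N).Connected := by
    haveI : Nonempty (Fin (2 * N + 4)) := ⟨⟨0, by omega⟩⟩
    refine SimpleGraph.Connected.mk ?_
    intro u v
    exact (heap_reach N u.1 u.2).trans (heap_reach N v.1 v.2).symm
  refine ⟨hc, ?_⟩
  apply le_antisymm
  · have hsub : (heapG N).edgeSet ⊆ Set.range
        (fun j : Fin (2 * N + 3) => (s(⟨j.1 + 1, by omega⟩, ⟨(j.1 + 1 - 2) / 2, by omega⟩) :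
          Sym2 (Fin (2 * N + 4)))) := by
      intro e
      induction e with
      | _ i j =>
        intro h
        rw [SimpleGraph.mem_edgeSet] at h
        rcases h with ⟨h1, h2⟩ | ⟨h1, h2⟩
        · refine ⟨⟨j.1 - 1, by omega⟩, ?_⟩
          simp only [Sym2.eq_iff, Fin.ext_iff]
          omega
        · refine ⟨⟨i.1 - 1, by omega⟩, ?_⟩
          simp only [Sym2.eq_iff, Fin.ext_iff]
          omega
    have h1 := Set.ncard_le_ncard hsub (Set.toFinite _)
    have h2 : (Set.range
        (fun j : Fin (2 * N + 3) => (s(⟨j.1 + 1, by omega⟩, ⟨(j.1 + 1 - 2) / 2, by omega⟩) :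
          Sym2 (Fin (2 * N + 4))))).ncard ≤ 2 * N + 3 := by
      rw [← Set.image_univ]
      refine (Set.ncard_image_le (Set.toFinite _)).trans ?_
      simp
    rw [Nat.card_coe_set_eq, Nat.card_fin]
    omega
  · exact hc.card_vert_le_card_edgeSet_add_one

lemma heap_leaf (N : ℕ) (i : Fin (2 * N + 4)) (hi : N + 1 ≤ i.1) :
    ((heapG N).neighborSet i).ncard = 1 := by
  rw [Set.ncard_eq_one]
  refine ⟨⟨(i.1 - 2) / 2, by omega⟩, ?_⟩
  ext j
  simp only [SimpleGraph.mem_neighborSet, heapG, Set.mem_singleton_iff, Fin.ext_iff]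
  omega

lemma heap_node (N : ℕ) (i : Fin (2 * N + 4)) (hi : i.1 < N + 1) :
    ((heapG N).neighborSet i).ncard = 3 := by
  rw [Set.ncard_eq_three]
  by_cases h0 : i.1 = 0
  · refine ⟨⟨1, by omega⟩, ⟨2, by omega⟩, ⟨3, by omega⟩, ?_, ?_, ?_, ?_⟩
    · simp
    · simp
    · simp
    ext j
    simp only [SimpleGraph.mem_neighborSet, heapG, Set.mem_singleton_iff, Set.mem_insert_iff,
      Fin.ext_iff]
    omega
  · refine ⟨⟨(i.1 - 2) / 2, by omega⟩, ⟨2 * i.1 + 2, by omega⟩, ⟨2 * i.1 + 3, by omega⟩,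
      ?_, ?_, ?_, ?_⟩
    · simp only [ne_eq, Fin.ext_iff]; omega
    · simp only [ne_eq, Fin.ext_iff]; omega
    · simp only [ne_eq, Fin.ext_iff]; omega
    ext j
    simp only [SimpleGraph.mem_neighborSet, heapG, Set.mem_singleton_iff, Set.mem_insert_iff,
      Fin.ext_iff]
    omega

lemma exists_branchDecomp (V : Type) [Fintype V] (h : 3 ≤ Fintype.card V) :
    Nonempty (BranchDecomp V) := by
  obtain ⟨N, hN⟩ : ∃ N, Fintype.card V = N + 3 := ⟨Fintype.card V - 3, by omega⟩
  let e : V ≃ Fin (N + 3) := Fintype.equivFinOfCardEq hN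
  refine ⟨{ L := Fin (2 * N + 4), finL := inferInstance, T := heapG N, isTree := heap_tree N,
            two_le := by simp, subcubic := ?_, toLeaf := fun v => ⟨(e v).1 + (N + 1), by omega⟩,
            inj := ?_, mem_leaf := ?_, surj := ?_ }⟩
  · intro t
    by_cases ht : N + 1 ≤ t.1
    · exact Or.inl (heap_leaf N t ht)
    · exact Or.inr (heap_node N t (by omega))
  · intro u v huv
    simp only [Fin.ext_iff] at huv
    exact e.injective (Fin.ext (by omega))
  · intro v
    exact heap_leaf N _ (by simp)
  · intro t ht
    have h1 : N + 1 ≤ t.1 := by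
      by_contra hlt
      rw [heap_node N t (by omega)] at ht
      omega
    refine ⟨e.symm ⟨t.1 - (N + 1), by omega⟩, ?_⟩
    apply Fin.ext
    simp
    omega

/-! ### Balanced cuts -/

lemma side_cover {V : Type} (bd : BranchDecomp V) (t : bd.L) (v : V) (hv : bd.toLeaf v ≠ t) :
    ∃ u, bd.T.Adj t u ∧ v ∈ bd.side u t := by
  obtain ⟨p, hp⟩ := (bd.isTree.1.preconnected t (bd.toLeaf v)).exists_isPath
  cases p with
  | nil => exact absurd rfl hv
  | @cons _ u _ hadj q =>
    refine ⟨u, hadj, ?_⟩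
    rw [SimpleGraph.Walk.cons_isPath_iff] at hp
    change (bd.T.deleteEdges {s(u, t)}).Reachable u (bd.toLeaf v)
    refine ⟨q.toDeleteEdges _ ?_⟩
    intro e he hmem
    rw [Set.mem_singleton_iff] at hmem
    subst hmem
    exact hp.2 (q.snd_mem_support_of_mem_edges he)

lemma side_disj {V : Type} (bd : BranchDecomp V) (t u : bd.L) (h : bd.T.Adj t u) (v : V)
    (h1 : v ∈ bd.side t u) (h2 : v ∈ bd.side u t) : False := by
  have hb := SimpleGraph.isAcyclic_iff_forall_adj_isBridge.1 bd.isTree.2 h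
  rw [SimpleGraph.isBridge_iff] at hb
  apply hb
  have h2' : (bd.T.deleteEdges {s(t, u)}).Reachable u (bd.toLeaf v) := by
    have : (bd.T.deleteEdges {s(u, t)}).Reachable u (bd.toLeaf v) := h2
    rwa [Sym2.eq_swap] at this
  have h1' : (bd.T.deleteEdges {s(t, u)}).Reachable t (bd.toLeaf v) := h1
  exact h1'.trans h2'.symm

lemma balanced {V X : Type} [Fintype X] (f : X → V) (hf : Function.Injective f)
    (bd : BranchDecomp V) (m : ℕ) (hm : 1 ≤ m) (hX : 3 * m ≤ Fintype.card X) :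
    ∃ t u, bd.T.Adj t u ∧ m ≤ (Finset.univ.filter fun x => f x ∈ bd.side t u).card ∧
      m ≤ (Finset.univ.filter fun x => f x ∉ bd.side t u).card := by
  by_contra hcon
  push Not at hcon
  haveI := bd.finL
  haveI : Fintype bd.L := Fintype.ofFinite _
  let S : bd.L → bd.L → Finset X := fun t u => Finset.univ.filter fun x => f x ∈ bd.side t u
  have step : ∀ t, ∃ u, bd.T.Adj t u ∧ m ≤ (S u t).card := by
    intro t
    by_contra hno
    push Not at hno
    have hcov : (Finset.univ : Finset X) ⊆ (Finset.univ.filter fun x => bd.toLeaf (f x) = t) ∪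
        (bd.T.neighborFinset t).biUnion (fun u => S u t) := by
      intro x _
      by_cases hx : bd.toLeaf (f x) = t
      · simp [hx]
      · obtain ⟨u, hu, hs⟩ := side_cover bd t (f x) hx
        simp only [Finset.mem_union, Finset.mem_biUnion, SimpleGraph.mem_neighborFinset]
        exact Or.inr ⟨u, hu, by simpa [S] using hs⟩
    have h1 := Finset.card_le_card hcov
    have h2 : (Finset.univ.filter fun x => bd.toLeaf (f x) = t).card ≤ 1 := by
      rw [Finset.card_le_one]
      intro a ha b hb
      simp only [Finset.mem_filter, Finset.mem_univ, true_and] at ha hb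
      exact hf (bd.inj (ha.trans hb.symm))
    have h3 : ((bd.T.neighborFinset t).biUnion (fun u => S u t)).card
        ≤ (bd.T.neighborFinset t).card * (m - 1) := by
      apply Finset.card_biUnion_le_card_mul
      intro u hu
      have := hno u (by simpa using hu)
      omega
    have h4 : (bd.T.neighborFinset t).card ≤ 3 := by
      have : (bd.T.neighborSet t).ncard = (bd.T.neighborFinset t).card := by
        rw [Set.ncard_eq_toFinset_card']
        rfl
      rcases bd.subcubic t with h | h <;> omega
    have h5 := Nat.mul_le_mul_right (m - 1) h4
    have h6 := Finset.card_union_le (Finset.univ.filter fun x => bd.toLeaf (f x) = t)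
        ((bd.T.neighborFinset t).biUnion (fun u => S u t))
    rw [Finset.card_univ] at h1
    omega
  choose g hg1 hg2 using step
  have hcard := bd.isTree.card_edgeFinset
  obtain ⟨t, _, t', _, hne, heq⟩ := Finset.exists_ne_map_eq_of_card_lt_of_maps_to
    (s := (Finset.univ : Finset bd.L)) (t := bd.T.edgeFinset) (f := fun t => s(t, g t))
    (by rw [Finset.card_univ]; omega)
    (by intro t _; simpa using hg1 t)
  simp only [Sym2.eq_iff] at heq
  rcases heq with ⟨h, _⟩ | ⟨h1, h2⟩
  · exact hne h
  have a1 := hcon (g t) t (hg1 t).symm (hg2 t)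
  have a2 := hcon (g t') t' (hg1 t').symm (hg2 t')
  rw [← h1, ← h2] at a2
  have hcov : (Finset.univ : Finset X) ⊆ (Finset.univ.filter fun x => f x ∉ bd.side (g t) t) ∪
      (Finset.univ.filter fun x => f x ∉ bd.side t (g t)) := by
    intro x _
    simp only [Finset.mem_union, Finset.mem_filter, Finset.mem_univ, true_and]
    by_contra hx
    push Not at hx
    exact side_disj bd t (g t) (hg1 t) (f x) hx.2 hx.1
  have h3 := (Finset.card_le_card hcov).trans (Finset.card_union_le _ _)
  rw [Finset.card_univ] at h3
  omega

/-! ### The tournament -/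

def tourE (n : ℕ) : Fin n ⊕ (Fin n × Fin n) → Fin n ⊕ (Fin n × Fin n) → Prop
  | .inl i, .inl j => i < j
  | .inl i, .inr p => i = p.1 ∨ i = p.2
  | .inr p, .inl i => ¬(i = p.1 ∨ i = p.2)
  | .inr p, .inr q => p.1 < q.1 ∨ (p.1 = q.1 ∧ p.2 < q.2)

lemma nu_ge {V : Type} [Finite V] (D : V → V → Prop) (M : Finset (V × V))
    (h : IsIndMatching D M) : M.card ≤ nu D := by
  haveI := Fintype.ofFinite V
  refine le_csSup ⟨Fintype.card (V × V), ?_⟩ ⟨M, h, rfl⟩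
  rintro _ ⟨M, -, rfl⟩
  exact Finset.card_le_univ M

lemma nu_cut_ge {V ι : Type} [Finite V] (E : V → V → Prop) (P Q : Set V) (hPQ : ∀ v ∈ P, v ∉ Q)
    (I : Finset ι) (c y : ι → V) (hc : ∀ i ∈ I, c i ∈ P) (hy : ∀ i ∈ I, y i ∈ Q)
    (cinj : Function.Injective c) (yinj : Function.Injective y)
    (hE : ∀ i j, E (c i) (y j) ↔ i = j) : I.card ≤ nu (cutRel E P Q) := by
  have hcard : (I.image fun i => (c i, y i)).card = I.card :=
    Finset.card_image_of_injective _ fun i j h => cinj (Prod.ext_iff.1 h).1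
  rw [← hcard]
  apply nu_ge
  constructor
  · intro e he
    obtain ⟨i, hi, rfl⟩ := Finset.mem_image.1 he
    exact ⟨hc i hi, hy i hi, (hE i i).2 rfl⟩
  · intro e he f hf hne
    obtain ⟨i, hi, rfl⟩ := Finset.mem_image.1 he
    obtain ⟨j, hj, rfl⟩ := Finset.mem_image.1 hf
    have hij : i ≠ j := fun h => hne (by rw [h])
    have ci := hc i hi
    have cj := hc j hj
    have yi := hy i hi
    have yj := hy j hj
    rintro x (rfl | rfl) z (rfl | rfl)
    · exact ⟨fun h => hij (cinj h), fun h => hPQ _ cj h.2.1⟩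
    · exact ⟨fun h => hPQ _ ci (by simp only at h; rw [h]; exact yj),
        fun h => hij ((hE i j).1 h.2.2)⟩
    · exact ⟨fun h => hPQ _ cj (by simp only at h; rw [← h]; exact yi),
        fun h => hPQ _ h.1 yi⟩
    · exact ⟨fun h => hij (yinj h), fun h => hPQ _ h.1 yi⟩

lemma cut_ge (n k : ℕ) (A : Set (Fin n ⊕ (Fin n × Fin n)))
    (h1 : 2 * k ≤ (Finset.univ.filter fun x : Fin n => Sum.inl x ∈ A).card)
    (h2 : 2 * k ≤ (Finset.univ.filter fun x : Fin n => Sum.inl x ∉ A).card) :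
    k ≤ bimimCut (tourE n) A := by
  obtain ⟨a, ha⟩ : ∃ a : Fin (2 * k) ↪ Fin n, ∀ i, Sum.inl (a i) ∈ A := by
    let e := (Finset.univ.filter fun x : Fin n => Sum.inl x ∈ A).orderEmbOfCardLe h1
    refine ⟨e.toEmbedding, fun i => ?_⟩
    have := Finset.orderEmbOfCardLe_mem _ h1 i
    simpa using this
  obtain ⟨b, hb⟩ : ∃ b : Fin (2 * k) ↪ Fin n, ∀ i, Sum.inl (b i) ∉ A := by
    let e := (Finset.univ.filter fun x : Fin n => Sum.inl x ∉ A).orderEmbOfCardLe h2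
    refine ⟨e.toEmbedding, fun i => ?_⟩
    have := Finset.orderEmbOfCardLe_mem _ h2 i
    simpa using this
  have hab : ∀ i j, a i ≠ b j := fun i j h => hb j (h ▸ ha i)
  let y : Fin (2 * k) → Fin n ⊕ (Fin n × Fin n) := fun i => Sum.inr (a i, b i)
  have yinj : Function.Injective y := by
    intro i j h
    simp only [y, Sum.inr.injEq, Prod.mk.injEq] at h
    exact a.injective h.1
  have hsum := Finset.card_filter_add_card_filter_not (s := (Finset.univ : Finset (Fin (2 * k))))
    (fun i => y i ∈ A)
  rw [Finset.card_univ, Fintype.card_fin] at hsum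
  have g1 : (Finset.univ.filter fun i => y i ∈ A).card ≤ nu (cutRel (tourE n) Aᶜ A) := by
    refine nu_cut_ge _ _ _ (fun v hv => hv) _ (fun i => Sum.inl (b i)) y (fun i _ => hb i)
      (fun i hi => by simpa using hi) (fun i j h => b.injective (Sum.inl.inj h)) yinj ?_
    intro i j
    simp only [tourE, y, b.injective.eq_iff]
    exact ⟨fun h => h.resolve_left (fun h => hab _ _ h.symm), Or.inr⟩
  have g2 : (Finset.univ.filter fun i => ¬ y i ∈ A).card ≤ nu (cutRel (tourE n) A Aᶜ) := by
    refine nu_cut_ge _ A Aᶜ (fun v hv h => h hv) _ (fun i => Sum.inl (a i)) y (fun i _ => ha i)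
      (fun i hi => by simpa using hi) (fun i j h => a.injective (Sum.inl.inj h)) yinj ?_
    intro i j
    simp only [tourE, y, a.injective.eq_iff]
    exact ⟨fun h => h.resolve_right (hab _ _), Or.inl⟩
  unfold bimimCut
  omega

theorem stmt_3 (k : ℕ) (hk : 1 ≤ k) :
    ∃ (V : Type) (_ : Fintype V) (E : V → V → Prop),
      (∀ v, ¬E v v) ∧ (∀ u v : V, u ≠ v → (E u v ↔ ¬E v u)) ∧ k ≤ bimimw E := by
  refine ⟨Fin (6 * k) ⊕ (Fin (6 * k) × Fin (6 * k)), inferInstance, tourE (6 * k), ?_, ?_, ?_⟩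
  · rintro (i | p) <;> simp [tourE]
  · rintro (i | ⟨p, q⟩) (j | ⟨r, s⟩) h
    · simp only [tourE, ne_eq, Sum.inl.injEq, Fin.ext_iff, Fin.lt_def] at h ⊢
      omega
    · simp only [tourE, not_not]
    · simp only [tourE]
    · simp only [tourE, ne_eq, Sum.inr.injEq, Prod.mk.injEq, Fin.ext_iff, Fin.lt_def] at h ⊢
      omega
  · unfold bimimw
    obtain ⟨bd0⟩ := exists_branchDecomp (Fin (6 * k) ⊕ (Fin (6 * k) × Fin (6 * k)))
      (by rw [Fintype.card_sum, Fintype.card_fin]; omega)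
    refine le_csInf ⟨_, bd0, rfl⟩ ?_
    rintro _ ⟨bd, rfl⟩
    obtain ⟨t, u, hadj, h1, h2⟩ := balanced (X := Fin (6 * k))
      (V := Fin (6 * k) ⊕ (Fin (6 * k) × Fin (6 * k))) Sum.inl Sum.inl_injective bd (2 * k)
      (by omega) (by rw [Fintype.card_fin]; omega)
    refine (cut_ge (6 * k) k (bd.side t u) h1 h2).trans ?_
    haveI := bd.finL
    refine le_csSup (Set.Finite.bddAbove ?_) ⟨t, u, hadj, rfl⟩
    refine (Set.finite_range fun p : bd.L × bd.L =>
      bimimCut (tourE (6 * k)) (bd.side p.1 p.2)).subset ?_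
    rintro _ ⟨t, u, -, rfl⟩
    exact ⟨(t, u), rfl⟩
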